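/- arXiv:1608.07424 — 5 statements merged into one kernel-verified Lean document; each statement's English description precedes it below -/
import Mathlib

section
/- For every real number t, the linear map J_{α^t} : ℝ⁶ → ℝ⁶ determined by (ι_v α^t) ∧ α^t = ι_{J_{α^t}(v)} dvol for all v ∈ ℝ⁶ satisfies J_{α^t} ∘ J_{α^t} = 4t · id_{ℝ⁶}. -/
/-- `dx3 i j k` is the alternating 3-form `dxⁱ ∧ dxʲ ∧ dxᵏ` on `ℝ⁶ = Fin 6 → ℝ`. -/
noncomputable def dx3 (i j k : Fin 6) : AlternatingMap ℝ (Fin 6 → ℝ) ℝ (Fin 3) :=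
  (Matrix.detRowAlternating : AlternatingMap ℝ (Fin 3 → ℝ) ℝ (Fin 3)).compLinearMap
    (LinearMap.funLeft ℝ ℝ ![i, j, k])

/-- The volume form `dx¹ ∧ dx² ∧ dx³ ∧ dx⁴ ∧ dx⁵ ∧ dx⁶` on `ℝ⁶`. -/
noncomputable def dvol : AlternatingMap ℝ (Fin 6 → ℝ) ℝ (Fin 6) :=
  Matrix.detRowAlternating

/-- The wedge product of alternating forms on `ℝ⁶` (shuffle convention). -/
noncomputable def wedge {m n : ℕ} (a : AlternatingMap ℝ (Fin 6 → ℝ) ℝ (Fin m))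
    (b : AlternatingMap ℝ (Fin 6 → ℝ) ℝ (Fin n)) :
    AlternatingMap ℝ (Fin 6 → ℝ) ℝ (Fin (m + n)) :=
  (((TensorProduct.lid ℝ ℝ).toLinearMap.compAlternatingMap
    (AlternatingMap.domCoprod a b)).domDomCongr finSumFinEquiv)

/-- `α^t = dx^{135} − dx^{146} − dx^{236} + t·dx^{245}` (0-based indices). -/
noncomputable def alphaT (t : ℝ) : AlternatingMap ℝ (Fin 6 → ℝ) ℝ (Fin 3) :=
  dx3 0 2 4 - dx3 0 3 5 - dx3 1 2 5 + t • dx3 1 3 4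

open Matrix

/-- The form `dx^{f 0} ∧ ⋯ ∧ dx^{f (n-1)}` on `ℝ⁶`. -/
noncomputable def dxForm {n : ℕ} (f : Fin n → Fin 6) :
    AlternatingMap ℝ (Fin 6 → ℝ) ℝ (Fin n) :=
  MultilinearMap.alternatization
    ((MultilinearMap.mkPiAlgebra ℝ (Fin n) ℝ).compLinearMap fun i => LinearMap.proj (f i))

theorem dxForm_apply {n : ℕ} (f : Fin n → Fin 6) (v : Fin n → Fin 6 → ℝ) :
    dxForm f v = det (of fun i j => v i (f j)) := by
  simp [dxForm, MultilinearMap.alternatization_apply, det_apply]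

theorem dx3_eq_dxForm (i j k : Fin 6) : dx3 i j k = dxForm ![i, j, k] := by
  ext v
  rw [dxForm_apply]
  rfl

theorem AlternatingMap.finset_sum_apply {n : ℕ} {ι : Type*} (s : Finset ι)
    (F : ι → AlternatingMap ℝ (Fin 6 → ℝ) ℝ (Fin n)) (v : Fin n → Fin 6 → ℝ) :
    (∑ i ∈ s, F i) v = ∑ i ∈ s, F i v :=
  map_sum (⟨⟨fun a => a v, rfl⟩, fun _ _ => rfl⟩ :
    AlternatingMap ℝ (Fin 6 → ℝ) ℝ (Fin n) →+ ℝ) F s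

theorem dxForm_curryLeft {n : ℕ} (f : Fin (n + 1) → Fin 6) (v : Fin 6 → ℝ) :
    (dxForm f).curryLeft v =
      ∑ i : Fin (n + 1), ((-1) ^ (i : ℕ) * v (f i)) • dxForm (f ∘ i.succAbove) := by
  ext w
  simp only [AlternatingMap.curryLeft_apply_apply, dxForm_apply, det_succ_row_zero,
    AlternatingMap.finset_sum_apply, AlternatingMap.smul_apply, smul_eq_mul]
  rfl

theorem dx3_curryLeft (i j k : Fin 6) (v : Fin 6 → ℝ) :
    (dx3 i j k).curryLeft v =
      v i • dxForm ![j, k] - v j • dxForm ![i, k] + v k • dxForm ![i, j] := by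
  have h0 : ![i, j, k] ∘ Fin.succAbove 0 = ![j, k] := by ext x; fin_cases x <;> rfl
  have h1 : ![i, j, k] ∘ Fin.succAbove 1 = ![i, k] := by ext x; fin_cases x <;> rfl
  have h2 : ![i, j, k] ∘ Fin.succAbove 2 = ![i, j] := by ext x; fin_cases x <;> rfl
  rw [dx3_eq_dxForm, dxForm_curryLeft, Fin.sum_univ_three, h0, h1, h2]
  ext w
  simp [sub_eq_add_neg]

theorem alphaT_curryLeft (t : ℝ) (v : Fin 6 → ℝ) :
    (alphaT t).curryLeft v =
      (dx3 0 2 4).curryLeft v - (dx3 0 3 5).curryLeft v - (dx3 1 2 5).curryLeft v +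
        t • (dx3 1 3 4).curryLeft v := rfl

theorem wedge_dxForm {m n : ℕ} (f : Fin m → Fin 6) (g : Fin n → Fin 6) :
    wedge (dxForm f) (dxForm g) = dxForm (Fin.append f g) := by
  ext v
  simp only [wedge, dxForm, ← MultilinearMap.domCoprod_alternization,
    AlternatingMap.domDomCongr_apply, LinearMap.compAlternatingMap_apply,
    MultilinearMap.alternatization_apply, map_sum]
  refine Fintype.sum_equiv finSumFinEquiv.permCongr _ _ fun σ => ?_
  rw [Equiv.Perm.sign_permCongr, Units.smul_def, Units.smul_def, map_zsmul]
  simp [Fin.prod_univ_add]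

section Bilinear

variable {m n : ℕ} (a a' : AlternatingMap ℝ (Fin 6 → ℝ) ℝ (Fin m))
  (b b' : AlternatingMap ℝ (Fin 6 → ℝ) ℝ (Fin n)) (c : ℝ)

theorem wedge_add_left : wedge (a + a') b = wedge a b + wedge a' b := by
  ext v
  simp [wedge, ← AlternatingMap.domCoprod'_apply, TensorProduct.add_tmul]

theorem wedge_sub_left : wedge (a - a') b = wedge a b - wedge a' b := by
  ext v
  simp [wedge, ← AlternatingMap.domCoprod'_apply, TensorProduct.sub_tmul]

theorem wedge_smul_left : wedge (c • a) b = c • wedge a b := by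
  ext v
  simp [wedge, ← AlternatingMap.domCoprod'_apply, ← TensorProduct.smul_tmul']

theorem wedge_add_right : wedge a (b + b') = wedge a b + wedge a b' := by
  ext v
  simp [wedge, ← AlternatingMap.domCoprod'_apply, TensorProduct.tmul_add]

theorem wedge_sub_right : wedge a (b - b') = wedge a b - wedge a b' := by
  ext v
  simp [wedge, ← AlternatingMap.domCoprod'_apply, TensorProduct.tmul_sub]

theorem wedge_smul_right : wedge a (c • b) = c • wedge a b := by
  ext v
  simp [wedge, ← AlternatingMap.domCoprod'_apply]

end Bilinear

theorem dxForm_apply_single {n : ℕ} (f g : Fin n → Fin 6) :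
    dxForm f (fun i => Pi.single (g i) 1) =
      ((det (of fun i j => if f j = g i then 1 else 0) : ℤ) : ℝ) := by
  rw [dxForm_apply, Int.cast_det]
  congr 1
  ext i j
  simp [Pi.single_apply]

theorem dxForm_apply_single_self {n : ℕ} (f : Fin n → Fin 6) (hf : Function.Injective f) :
    dxForm f (fun i => Pi.single (f i) 1) = 1 := by
  rw [dxForm_apply_single]
  have : (of fun i j => if f j = f i then 1 else 0 : Matrix (Fin n) (Fin n) ℤ) = 1 := by
    ext i j
    simp [Matrix.one_apply, hf.eq_iff, eq_comm]
  simp [this]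

theorem dxForm_apply_single_eq_zero {n : ℕ} (f g : Fin n → Fin 6)
    (h : ¬ ∀ i, ∃ j, f j = g i) : dxForm f (fun i => Pi.single (g i) 1) = 0 := by
  push Not at h
  obtain ⟨i, hi⟩ := h
  rw [dxForm_apply_single, det_eq_zero_of_row_eq_zero i fun j => by simp [hi j], Int.cast_zero]

theorem dxForm_apply_single_eq_one {n : ℕ} (f g : Fin n → Fin 6)
    (h : det (of fun i j => if f j = g i then 1 else 0 : Matrix (Fin n) (Fin n) ℤ) = 1) :
    dxForm f (fun i => Pi.single (g i) 1) = 1 := by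
  rw [dxForm_apply_single, h, Int.cast_one]

theorem dxForm_apply_single_eq_neg_one {n : ℕ} (f g : Fin n → Fin 6)
    (h : det (of fun i j => if f j = g i then 1 else 0 : Matrix (Fin n) (Fin n) ℤ) = -1) :
    dxForm f (fun i => Pi.single (g i) 1) = -1 := by
  rw [dxForm_apply_single, h, Int.cast_neg, Int.cast_one]

theorem dvol_eq_dxForm : dvol = dxForm id := by
  ext v
  simp only [dxForm_apply, id]
  change det v = det v
  rfl

theorem dvol_curryLeft_apply_single (w : Fin 6 → ℝ) (k : Fin 6) :
    dvol.curryLeft w (fun i => Pi.single (k.succAbove i) 1) = (-1) ^ (k : ℕ) * w k := by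
  rw [dvol_eq_dxForm, dxForm_curryLeft, AlternatingMap.finset_sum_apply, Finset.sum_eq_single k]
  · rw [AlternatingMap.smul_apply, Function.id_comp,
      dxForm_apply_single_self _ Fin.succAbove_right_injective]
    simp
  · intro i _ hik
    obtain ⟨j, hj⟩ := Fin.exists_succAbove_eq hik
    rw [AlternatingMap.smul_apply, dxForm_apply_single_eq_zero, smul_zero]
    push Not
    exact ⟨j, fun l => by simp [hj, Fin.succAbove_ne]⟩
  · simp

theorem wedge_dxForm_two_three (i j a b c : Fin 6) :
    wedge (dxForm ![i, j]) (dxForm ![a, b, c]) = dxForm ![i, j, a, b, c] := by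
  rw [wedge_dxForm]
  congr 1
  ext x
  fin_cases x <;> rfl

theorem wedge_curryLeft_alphaT_apply_single (t : ℝ) (v : Fin 6 → ℝ) (k : Fin 6) :
    wedge ((alphaT t).curryLeft v) (alphaT t) (fun i => Pi.single (k.succAbove i) 1) =
      (-1) ^ (k : ℕ) *
        ![-2 * t * v 1, -2 * v 0, -2 * t * v 3, -2 * v 2, 2 * v 5, 2 * t * v 4] k := by
  rw [alphaT_curryLeft]
  simp only [alphaT, dx3_curryLeft, wedge_add_left, wedge_sub_left, wedge_smul_left,
    wedge_add_right, wedge_sub_right, wedge_smul_right, AlternatingMap.add_apply,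
    AlternatingMap.sub_apply, AlternatingMap.smul_apply]
  simp only [dx3_eq_dxForm, wedge_dxForm_two_three]
  fin_cases k <;>
  · simp (disch := decide) only [dxForm_apply_single_eq_zero]
    simp (disch := decide +kernel) only [dxForm_apply_single_eq_one,
      dxForm_apply_single_eq_neg_one]
    simp
    try ring

/-- For every real `t`, the linear map `J_{α^t}` determined by
`(ι_v α^t) ∧ α^t = ι_{J v} dvol` satisfies `J ∘ J = 4t · id`. -/
theorem J_alphaT_sq (t : ℝ) (J : (Fin 6 → ℝ) →ₗ[ℝ] (Fin 6 → ℝ))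
    (hJ : ∀ v : Fin 6 → ℝ,
      wedge ((alphaT t).curryLeft v) (alphaT t) = dvol.curryLeft (J v)) :
    J ∘ₗ J = (4 * t) • (LinearMap.id : (Fin 6 → ℝ) →ₗ[ℝ] (Fin 6 → ℝ)) := by
  have hdvol := dvol_curryLeft_apply_single
  generalize dvol = D at hJ hdvol
  have hJ_apply (v : Fin 6 → ℝ) :
      J v = ![-2 * t * v 1, -2 * v 0, -2 * t * v 3, -2 * v 2, 2 * v 5, 2 * t * v 4] := by
    ext k
    have h := wedge_curryLeft_alphaT_apply_single t v k
    rw [hJ] at h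
    have hk : (-1 : ℝ) ^ (k : ℕ) ≠ 0 := pow_ne_zero _ (by norm_num)
    exact mul_left_cancel₀ hk ((hdvol (J v) k).symm.trans h)
  ext v k
  fin_cases k <;> simp [hJ_apply] <;> ring
end

section
/- Let α be a non-degenerate 3-form on ℝ⁶. Then λ_α > 0 if and only if there exists a linear isomorphism g : ℝ⁶ → ℝ⁶ with g*α = α_(i). -/
/-- `α_(i) = dx^{123} + dx^{456}`. -/
noncomputable def alphaI : AlternatingMap ℝ (Fin 6 → ℝ) ℝ (Fin 3) :=
  dx3 0 1 2 + dx3 3 4 5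

/-- `α_(ii) = dx^{135} − dx^{146} − dx^{236} − dx^{245}`. -/
noncomputable def alphaII : AlternatingMap ℝ (Fin 6 → ℝ) ℝ (Fin 3) :=
  dx3 0 2 4 - dx3 0 3 5 - dx3 1 2 5 - dx3 1 3 4

/-- `α_(iii) = dx^{156} − dx^{246} + dx^{345}`. -/
noncomputable def alphaIII : AlternatingMap ℝ (Fin 6 → ℝ) ℝ (Fin 3) :=
  dx3 0 4 5 - dx3 1 3 5 + dx3 2 3 4

/-- `complement i` lists the elements of `Fin 6` other than `i` in increasing order. -/
def complement : Fin 6 → Fin 5 → Fin 6 :=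
  ![![1, 2, 3, 4, 5], ![0, 2, 3, 4, 5], ![0, 1, 3, 4, 5], ![0, 1, 2, 4, 5], ![0, 1, 2, 3, 5],
    ![0, 1, 2, 3, 4]]

theorem complement_eq_succAbove : complement = Fin.succAbove := by
  decide

/-- The matrix of `J` in terms of the coefficients of the 3-form. -/
def hitchinMatrix (A : Fin 6 → Fin 6 → Fin 6 → ℝ) : Matrix (Fin 6) (Fin 6) ℝ :=
  Matrix.of fun i j =>
    let p := complement i
    (-1) ^ (i : ℕ) *
      (A j (p 0) (p 1) * A (p 2) (p 3) (p 4) - A j (p 0) (p 2) * A (p 1) (p 3) (p 4)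
        - A j (p 0) (p 3) * A (p 2) (p 1) (p 4) - A j (p 0) (p 4) * A (p 2) (p 3) (p 1)
        - A j (p 2) (p 1) * A (p 0) (p 3) (p 4) - A j (p 3) (p 1) * A (p 2) (p 0) (p 4)
        - A j (p 4) (p 1) * A (p 2) (p 3) (p 0) + A j (p 2) (p 3) * A (p 0) (p 1) (p 4)
        + A j (p 2) (p 4) * A (p 0) (p 3) (p 1) + A j (p 3) (p 4) * A (p 2) (p 0) (p 1))

/-- Full antisymmetry of a three-index array. -/
structure IsSkewArray (A : Fin 6 → Fin 6 → Fin 6 → ℝ) : Prop where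
  swap_left : ∀ i j k, A i j k = -A j i k
  swap_right : ∀ i j k, A i j k = -A i k j

namespace IsSkewArray

variable {A : Fin 6 → Fin 6 → Fin 6 → ℝ}

theorem eq_zero_left (h : IsSkewArray A) (i k : Fin 6) : A i i k = 0 := by
  linarith [h.swap_left i i k]

theorem eq_zero_right (h : IsSkewArray A) (i k : Fin 6) : A k i i = 0 := by
  linarith [h.swap_right k i i]

theorem eq_zero_outer (h : IsSkewArray A) (i k : Fin 6) : A i k i = 0 := by
  rw [h.swap_left, h.eq_zero_right, neg_zero]

theorem sort_left (h : IsSkewArray A) (i j k : Fin 6) (_ : j < i) : A i j k = -A j i k :=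
  h.swap_left i j k

theorem sort_right (h : IsSkewArray A) (i j k : Fin 6) (_ : k < j) : A i j k = -A i k j :=
  h.swap_right i j k

set_option maxHeartbeats 4000000 in
/-- The entries of `hitchinMatrix A` in terms of the `A i j k` with `i < j < k`. -/
theorem hitchinMatrix_eq (h : IsSkewArray A) : hitchinMatrix A = !![
    (A 0 1 2 * A 3 4 5 - A 0 1 3 * A 2 4 5 + A 0 1 4 * A 2 3 5 - A 0 1 5 * A 2 3 4 + A 0 2 3 * A 1
      4 5 - A 0 2 4 * A 1 3 5 + A 0 2 5 * A 1 3 4 + A 0 3 4 * A 1 2 5 - A 0 3 5 * A 1 2 4 + A 0 4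
      5 * A 1 2 3),
      2 * (A 1 2 3 * A 1 4 5 - A 1 2 4 * A 1 3 5 + A 1 2 5 * A 1 3 4),
      2 * (A 1 2 3 * A 2 4 5 - A 1 2 4 * A 2 3 5 + A 1 2 5 * A 2 3 4),
      2 * (A 1 2 3 * A 3 4 5 - A 1 3 4 * A 2 3 5 + A 1 3 5 * A 2 3 4),
      2 * (A 1 2 4 * A 3 4 5 - A 1 3 4 * A 2 4 5 + A 1 4 5 * A 2 3 4),
      2 * (A 1 2 5 * A 3 4 5 - A 1 3 5 * A 2 4 5 + A 1 4 5 * A 2 3 5);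
    2 * (-A 0 2 3 * A 0 4 5 + A 0 2 4 * A 0 3 5 - A 0 2 5 * A 0 3 4),
      (A 0 1 2 * A 3 4 5 - A 0 1 3 * A 2 4 5 + A 0 1 4 * A 2 3 5 - A 0 1 5 * A 2 3 4 - A 0 2 3 * A
        1 4 5 + A 0 2 4 * A 1 3 5 - A 0 2 5 * A 1 3 4 - A 0 3 4 * A 1 2 5 + A 0 3 5 * A 1 2 4 - A
        0 4 5 * A 1 2 3),
      2 * (-A 0 2 3 * A 2 4 5 + A 0 2 4 * A 2 3 5 - A 0 2 5 * A 2 3 4),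
      2 * (-A 0 2 3 * A 3 4 5 + A 0 3 4 * A 2 3 5 - A 0 3 5 * A 2 3 4),
      2 * (-A 0 2 4 * A 3 4 5 + A 0 3 4 * A 2 4 5 - A 0 4 5 * A 2 3 4),
      2 * (-A 0 2 5 * A 3 4 5 + A 0 3 5 * A 2 4 5 - A 0 4 5 * A 2 3 5);
    2 * (A 0 1 3 * A 0 4 5 - A 0 1 4 * A 0 3 5 + A 0 1 5 * A 0 3 4),
      2 * (A 0 1 3 * A 1 4 5 - A 0 1 4 * A 1 3 5 + A 0 1 5 * A 1 3 4),
      (A 0 1 2 * A 3 4 5 + A 0 1 3 * A 2 4 5 - A 0 1 4 * A 2 3 5 + A 0 1 5 * A 2 3 4 + A 0 2 3 * A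
        1 4 5 - A 0 2 4 * A 1 3 5 + A 0 2 5 * A 1 3 4 - A 0 3 4 * A 1 2 5 + A 0 3 5 * A 1 2 4 - A
        0 4 5 * A 1 2 3),
      2 * (A 0 1 3 * A 3 4 5 - A 0 3 4 * A 1 3 5 + A 0 3 5 * A 1 3 4),
      2 * (A 0 1 4 * A 3 4 5 - A 0 3 4 * A 1 4 5 + A 0 4 5 * A 1 3 4),
      2 * (A 0 1 5 * A 3 4 5 - A 0 3 5 * A 1 4 5 + A 0 4 5 * A 1 3 5);
    2 * (-A 0 1 2 * A 0 4 5 + A 0 1 4 * A 0 2 5 - A 0 1 5 * A 0 2 4),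
      2 * (-A 0 1 2 * A 1 4 5 + A 0 1 4 * A 1 2 5 - A 0 1 5 * A 1 2 4),
      2 * (-A 0 1 2 * A 2 4 5 + A 0 2 4 * A 1 2 5 - A 0 2 5 * A 1 2 4),
      (-A 0 1 2 * A 3 4 5 - A 0 1 3 * A 2 4 5 - A 0 1 4 * A 2 3 5 + A 0 1 5 * A 2 3 4 + A 0 2 3 *
        A 1 4 5 + A 0 2 4 * A 1 3 5 - A 0 2 5 * A 1 3 4 + A 0 3 4 * A 1 2 5 - A 0 3 5 * A 1 2 4 -
        A 0 4 5 * A 1 2 3),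
      2 * (-A 0 1 4 * A 2 4 5 + A 0 2 4 * A 1 4 5 - A 0 4 5 * A 1 2 4),
      2 * (-A 0 1 5 * A 2 4 5 + A 0 2 5 * A 1 4 5 - A 0 4 5 * A 1 2 5);
    2 * (A 0 1 2 * A 0 3 5 - A 0 1 3 * A 0 2 5 + A 0 1 5 * A 0 2 3),
      2 * (A 0 1 2 * A 1 3 5 - A 0 1 3 * A 1 2 5 + A 0 1 5 * A 1 2 3),
      2 * (A 0 1 2 * A 2 3 5 - A 0 2 3 * A 1 2 5 + A 0 2 5 * A 1 2 3),
      2 * (A 0 1 3 * A 2 3 5 - A 0 2 3 * A 1 3 5 + A 0 3 5 * A 1 2 3),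
      (-A 0 1 2 * A 3 4 5 + A 0 1 3 * A 2 4 5 + A 0 1 4 * A 2 3 5 + A 0 1 5 * A 2 3 4 - A 0 2 3 *
        A 1 4 5 - A 0 2 4 * A 1 3 5 - A 0 2 5 * A 1 3 4 + A 0 3 4 * A 1 2 5 + A 0 3 5 * A 1 2 4 +
        A 0 4 5 * A 1 2 3),
      2 * (A 0 1 5 * A 2 3 5 - A 0 2 5 * A 1 3 5 + A 0 3 5 * A 1 2 5);
    2 * (-A 0 1 2 * A 0 3 4 + A 0 1 3 * A 0 2 4 - A 0 1 4 * A 0 2 3),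
      2 * (-A 0 1 2 * A 1 3 4 + A 0 1 3 * A 1 2 4 - A 0 1 4 * A 1 2 3),
      2 * (-A 0 1 2 * A 2 3 4 + A 0 2 3 * A 1 2 4 - A 0 2 4 * A 1 2 3),
      2 * (-A 0 1 3 * A 2 3 4 + A 0 2 3 * A 1 3 4 - A 0 3 4 * A 1 2 3),
      2 * (-A 0 1 4 * A 2 3 4 + A 0 2 4 * A 1 3 4 - A 0 3 4 * A 1 2 4),
      (-A 0 1 2 * A 3 4 5 + A 0 1 3 * A 2 4 5 - A 0 1 4 * A 2 3 5 - A 0 1 5 * A 2 3 4 - A 0 2 3 *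
        A 1 4 5 + A 0 2 4 * A 1 3 5 + A 0 2 5 * A 1 3 4 - A 0 3 4 * A 1 2 5 - A 0 3 5 * A 1 2 4 +
        A 0 4 5 * A 1 2 3)] := by
  ext i j
  fin_cases i <;> fin_cases j <;>
    simp [hitchinMatrix, complement, h.eq_zero_left,
      h.eq_zero_outer, h.sort_left, h.sort_right] <;>
    ring

theorem trace_hitchinMatrix (h : IsSkewArray A) : (hitchinMatrix A).trace = 0 := by
  rw [h.hitchinMatrix_eq]
  simp only [Matrix.trace, Matrix.diag, Fin.sum_univ_six, Matrix.of_apply, Matrix.cons_val]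
  ring

set_option maxHeartbeats 1000000 in
/-- The square of `hitchinMatrix A` is scalar. -/
theorem hitchinMatrix_mul_self (h : IsSkewArray A) :
    hitchinMatrix A * hitchinMatrix A =
      ((hitchinMatrix A * hitchinMatrix A) 0 0) • (1 : Matrix (Fin 6) (Fin 6) ℝ) := by
  rw [h.hitchinMatrix_eq]
  ext i j
  simp only [Matrix.mul_apply, Matrix.smul_apply, Fin.sum_univ_six, smul_eq_mul]
  fin_cases i <;> fin_cases j <;>
    simp only [Fin.zero_eta, Fin.mk_one, Fin.reduceFinMk, Matrix.of_apply, Matrix.cons_val,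
      Matrix.one_apply, Fin.reduceEq, if_true, if_false] <;>
    ring

set_option maxHeartbeats 1000000 in
/-- In coordinates, `α(Ju, v, w) = α(u, Jv, w)`. -/
theorem sum_hitchinMatrix_mul (h : IsSkewArray A) (i j k : Fin 6) :
    ∑ l, hitchinMatrix A l i * A l j k = ∑ l, hitchinMatrix A l j * A i l k := by
  rw [h.hitchinMatrix_eq]
  fin_cases i <;> fin_cases j <;> fin_cases k <;>
    simp only [Fin.zero_eta, Fin.mk_one, Fin.reduceFinMk, Fin.sum_univ_six, Matrix.of_apply,
      Matrix.cons_val, h.eq_zero_left, h.eq_zero_right, h.eq_zero_outer] <;>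
    (try simp only [h.sort_left, h.sort_right, Fin.reduceLT]) <;>
    ring

end IsSkewArray

open Equiv in
/-- Representatives of the `(2, 3)`-shuffles. -/
def shuffleRep : Fin 10 → Perm (Fin 2 ⊕ Fin 3) :=
  ![1, swap (.inl 1) (.inr 0), swap (.inl 1) (.inr 1), swap (.inl 1) (.inr 2),
    swap (.inl 0) (.inr 0), swap (.inl 0) (.inr 1), swap (.inl 0) (.inr 2),
    swap (.inl 0) (.inr 0) * swap (.inl 1) (.inr 1),
    swap (.inl 0) (.inr 0) * swap (.inl 1) (.inr 2),
    swap (.inl 0) (.inr 1) * swap (.inl 1) (.inr 2)]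

theorem shuffleRep_injective_aux : ∀ i j, (∀ x : Fin 2, ∃ y : Fin 2,
    (shuffleRep i)⁻¹ (shuffleRep j (.inl x)) = .inl y) → i = j := by
  decide +kernel

theorem card_modSumCongr : Nat.card (Equiv.Perm.ModSumCongr (Fin 2) (Fin 3)) = 10 := by
  have h := Subgroup.card_eq_card_quotient_mul_card_subgroup
    (Equiv.Perm.sumCongrHom (Fin 2) (Fin 3)).range
  rw [Nat.card_congr (MonoidHom.ofInjective
    (Equiv.Perm.sumCongrHom_injective (α := Fin 2) (β := Fin 3))).symm.toEquiv] at h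
  rw [Nat.card_prod, Nat.card_perm, Nat.card_perm, Nat.card_perm, Nat.card_sum] at h
  simp only [Nat.card_eq_fintype_card (α := Fin _), Fintype.card_fin, Nat.factorial] at h
  exact Nat.eq_of_mul_eq_mul_right (by norm_num : 0 < 12) h.symm

theorem shuffleRep_bijective : Function.Bijective (fun i => Quotient.mk'' (shuffleRep i) :
    Fin 10 → Equiv.Perm.ModSumCongr (Fin 2) (Fin 3)) := by
  rw [Nat.bijective_iff_injective_and_card]
  refine ⟨fun i j hij => shuffleRep_injective_aux i j fun x => ?_,
    (Nat.card_fin 10).trans card_modSumCongr.symm⟩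
  obtain ⟨⟨s, t⟩, h⟩ := QuotientGroup.leftRel_apply.mp (Quotient.exact' hij)
  exact ⟨s x, by simpa using (Equiv.congr_fun h (.inl x)).symm⟩

/-- The shuffle expansion of the wedge product of a 2-form and a 3-form. -/
theorem wedge_two_three_apply (a : AlternatingMap ℝ (Fin 6 → ℝ) ℝ (Fin 2))
    (b : AlternatingMap ℝ (Fin 6 → ℝ) ℝ (Fin 3)) (v : Fin 5 → Fin 6 → ℝ) :
    wedge a b v =
      a ![v 0, v 1] * b ![v 2, v 3, v 4] - a ![v 0, v 2] * b ![v 1, v 3, v 4]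
        - a ![v 0, v 3] * b ![v 2, v 1, v 4] - a ![v 0, v 4] * b ![v 2, v 3, v 1]
        - a ![v 2, v 1] * b ![v 0, v 3, v 4] - a ![v 3, v 1] * b ![v 2, v 0, v 4]
        - a ![v 4, v 1] * b ![v 2, v 3, v 0] + a ![v 2, v 3] * b ![v 0, v 1, v 4]
        + a ![v 2, v 4] * b ![v 0, v 3, v 1] + a ![v 3, v 4] * b ![v 2, v 0, v 1] := by
  have hsummand : ∀ σ : Equiv.Perm (Fin 2 ⊕ Fin 3),
      TensorProduct.lid ℝ ℝ (AlternatingMap.domCoprod.summand a b (Quotient.mk'' σ)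
        fun i => v (finSumFinEquiv i)) = (Equiv.Perm.sign σ : ℤ) •
        (a ![v (finSumFinEquiv (σ (.inl 0))), v (finSumFinEquiv (σ (.inl 1)))] *
          b ![v (finSumFinEquiv (σ (.inr 0))), v (finSumFinEquiv (σ (.inr 1))),
            v (finSumFinEquiv (σ (.inr 2)))]) := by
    intro σ
    rw [AlternatingMap.domCoprod.summand_mk'']
    simp
    rw [Units.smul_def, zsmul_eq_mul]
    congr 3 <;> · ext i; fin_cases i <;> rfl
  have : wedge a b v = ∑ σ, TensorProduct.lid ℝ ℝ (AlternatingMap.domCoprod.summand a b σ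
      fun i => v (finSumFinEquiv i)) := by
    simp [wedge, Function.comp_def, AlternatingMap.domCoprod_apply]
  refine this.trans ((Fintype.sum_bijective _ shuffleRep_bijective _ _ fun i =>
    (hsummand (shuffleRep i)).symm).symm.trans ?_)
  have h0 : v (finSumFinEquiv (.inl 0 : Fin 2 ⊕ Fin 3)) = v 0 := rfl
  have h1 : v (finSumFinEquiv (.inl 1 : Fin 2 ⊕ Fin 3)) = v 1 := rfl
  have h2 : v (finSumFinEquiv (.inr 0 : Fin 2 ⊕ Fin 3)) = v 2 := rfl
  have h3 : v (finSumFinEquiv (.inr 1 : Fin 2 ⊕ Fin 3)) = v 3 := rfl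
  have h4 : v (finSumFinEquiv (.inr 2 : Fin 2 ⊕ Fin 3)) = v 4 := rfl
  simp [Fin.sum_univ_succ, shuffleRep, Equiv.swap_apply_def, h0, h1, h2, h3, h4]
  ring

/-- The coefficients of a 3-form in the standard basis. -/
def coeff (α : AlternatingMap ℝ (Fin 6 → ℝ) ℝ (Fin 3)) (i j k : Fin 6) : ℝ :=
  α ![Pi.single i 1, Pi.single j 1, Pi.single k 1]

theorem map_swap_left (α : AlternatingMap ℝ (Fin 6 → ℝ) ℝ (Fin 3)) (u v w : Fin 6 → ℝ) :
    α ![u, v, w] = -α ![v, u, w] := by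
  rw [← α.map_swap _ (show (0 : Fin 3) ≠ 1 by decide)]
  congr 1
  ext i : 1
  fin_cases i <;> rfl

theorem map_swap_right (α : AlternatingMap ℝ (Fin 6 → ℝ) ℝ (Fin 3)) (u v w : Fin 6 → ℝ) :
    α ![u, v, w] = -α ![u, w, v] := by
  rw [← α.map_swap _ (show (1 : Fin 3) ≠ 2 by decide)]
  congr 1
  ext i : 1
  fin_cases i <;> rfl

theorem apply_sum_left (α : AlternatingMap ℝ (Fin 6 → ℝ) ℝ (Fin 3)) (c : Fin 6 → ℝ)
    (e : Fin 6 → Fin 6 → ℝ) (v w : Fin 6 → ℝ) :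
    α ![∑ l, c l • e l, v, w] = ∑ l, c l * α ![e l, v, w] := by
  have h (u : Fin 6 → ℝ) : α ![u, v, w] =
      α.toMultilinearMap.toLinearMap ![0, v, w] 0 u := by
    refine congrArg α ?_
    ext i : 1
    fin_cases i <;> rfl
  simp only [h, map_sum, map_smul, smul_eq_mul]

theorem apply_smul_left (α : AlternatingMap ℝ (Fin 6 → ℝ) ℝ (Fin 3)) (c : ℝ)
    (u v w : Fin 6 → ℝ) : α ![c • u, v, w] = c * α ![u, v, w] := by
  have h (u : Fin 6 → ℝ) : α ![u, v, w] = α.curryLeft u ![v, w] := rfl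
  rw [h, h, map_smul, AlternatingMap.smul_apply, smul_eq_mul]

theorem isSkewArray_coeff (α : AlternatingMap ℝ (Fin 6 → ℝ) ℝ (Fin 3)) :
    IsSkewArray (coeff α) where
  swap_left _ _ _ := map_swap_left ..
  swap_right _ _ _ := map_swap_right ..

theorem detRowAlternating_apply {n : Type*} [DecidableEq n] [Fintype n] (f : n → n → ℝ) :
    Matrix.detRowAlternating f = (Matrix.of f).det :=
  rfl

theorem dvol_curryLeft_apply (w : Fin 6 → ℝ) (f : Fin 5 → Fin 6 → ℝ) :
    dvol.curryLeft w f = Matrix.det (Matrix.of (Matrix.vecCons w f)) := by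
  rw [AlternatingMap.curryLeft_apply_apply, dvol, detRowAlternating_apply]

theorem dvol_curryLeft_succAbove (w : Fin 6 → ℝ) (i : Fin 6) :
    dvol.curryLeft w (fun k => Pi.single (i.succAbove k) 1) = (-1) ^ (i : ℕ) * w i := by
  rw [dvol_curryLeft_apply, Matrix.det_succ_row_zero, Finset.sum_eq_single i]
  · have : (Matrix.of (Matrix.vecCons w fun k => Pi.single (i.succAbove k) (1 : ℝ))).submatrix
        Fin.succ i.succAbove = 1 := by
      ext a b
      simp [Pi.single_apply, Matrix.one_apply, eq_comm]
    rw [this]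
    simp
  · intro j _ hj
    obtain ⟨k, rfl⟩ := Fin.exists_succAbove_eq hj
    refine mul_eq_zero_of_right _ (Matrix.det_eq_zero_of_row_eq_zero k fun l => ?_)
    simp [Pi.single_apply, Fin.succAbove_ne]
  · simp

section

variable {α : AlternatingMap ℝ (Fin 6 → ℝ) ℝ (Fin 3)} {J : (Fin 6 → ℝ) →ₗ[ℝ] (Fin 6 → ℝ)}

theorem apply_eq (hJ : ∀ v : Fin 6 → ℝ, wedge (α.curryLeft v) α = dvol.curryLeft (J v))
    (v : Fin 6 → ℝ) (f : Fin 5 → Fin 6 → ℝ) :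
    wedge (α.curryLeft v) α f = dvol.curryLeft (J v) f := by
  rw [hJ]

/-- The map `J` determined by `α` has matrix `hitchinMatrix (coeff α)`. -/
theorem toMatrix'_eq_hitchinMatrix
    (hJ : ∀ v : Fin 6 → ℝ, wedge (α.curryLeft v) α = dvol.curryLeft (J v)) :
    LinearMap.toMatrix' J = hitchinMatrix (coeff α) := by
  ext i j
  have h := apply_eq hJ (Pi.single j 1) (fun k => Pi.single (i.succAbove k) 1)
  rw [dvol_curryLeft_succAbove] at h
  rw [wedge_two_three_apply] at h
  have hsq : ((-1 : ℝ) ^ (i : ℕ)) * (-1) ^ (i : ℕ) = 1 := by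
    rw [← mul_pow]; simp
  have hJij : J (Pi.single j 1) i = (-1) ^ (i : ℕ) * ((-1) ^ (i : ℕ) * J (Pi.single j 1) i) := by
    rw [← mul_assoc, hsq, one_mul]
  rw [LinearMap.toMatrix'_apply, hJij, ← h]
  simp only [hitchinMatrix, complement_eq_succAbove, Matrix.of_apply]
  rfl

/-- `J ∘ J` is a scalar map. -/
theorem comp_self_eq
    (hJ : ∀ v : Fin 6 → ℝ, wedge (α.curryLeft v) α = dvol.curryLeft (J v)) :
    J ∘ₗ J = ((hitchinMatrix (coeff α) * hitchinMatrix (coeff α)) 0 0) • LinearMap.id := by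
  apply LinearMap.toMatrix'.injective
  rw [LinearMap.toMatrix'_comp, map_smul, LinearMap.toMatrix'_id, toMatrix'_eq_hitchinMatrix hJ]
  exact (isSkewArray_coeff α).hitchinMatrix_mul_self

theorem trace_eq_zero
    (hJ : ∀ v : Fin 6 → ℝ, wedge (α.curryLeft v) α = dvol.curryLeft (J v)) :
    LinearMap.trace ℝ (Fin 6 → ℝ) J = 0 := by
  rw [LinearMap.trace_eq_matrix_trace ℝ (Pi.basisFun ℝ (Fin 6)),
    LinearMap.toMatrix_eq_toMatrix', toMatrix'_eq_hitchinMatrix hJ]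
  exact (isSkewArray_coeff α).trace_hitchinMatrix

/-- `J` can be moved from the first to the second argument of `α`. -/
theorem apply_left_comm
    (hJ : ∀ v : Fin 6 → ℝ, wedge (α.curryLeft v) α = dvol.curryLeft (J v))
    (u v w : Fin 6 → ℝ) : α ![J u, v, w] = α ![u, J v, w] := by
  have h : (α : MultilinearMap ℝ (fun _ : Fin 3 => Fin 6 → ℝ) ℝ).compLinearMap
        ![J, LinearMap.id, LinearMap.id] =
      (α : MultilinearMap ℝ (fun _ : Fin 3 => Fin 6 → ℝ) ℝ).compLinearMap
        ![LinearMap.id, J, LinearMap.id] := by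
    refine Module.Basis.ext_multilinear (fun _ => Pi.basisFun ℝ (Fin 6)) fun t => ?_
    have hJ' (j : Fin 6) : J (Pi.single j 1) =
        ∑ l, hitchinMatrix (coeff α) l j • (Pi.single l 1 : Fin 6 → ℝ) := by
      ext l
      rw [← LinearMap.toMatrix'_apply, toMatrix'_eq_hitchinMatrix hJ]
      simp [Finset.sum_apply, Pi.single_apply]
    have hl (i j k : Fin 6) : α ![J (Pi.single i 1), Pi.single j 1, Pi.single k 1] =
        ∑ l, hitchinMatrix (coeff α) l i * coeff α l j k := by
      rw [hJ', apply_sum_left]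
      rfl
    have hr (i j k : Fin 6) : α ![Pi.single i 1, J (Pi.single j 1), Pi.single k 1] =
        ∑ l, hitchinMatrix (coeff α) l j * coeff α i l k := by
      rw [map_swap_left, hJ', apply_sum_left, ← Finset.sum_neg_distrib]
      refine Finset.sum_congr rfl fun l _ => ?_
      rw [map_swap_left, mul_neg, neg_neg]
      rfl
    have h := (hl (t 0) (t 1) (t 2)).trans
      (((isSkewArray_coeff α).sum_hitchinMatrix_mul _ _ _).trans (hr _ _ _).symm)
    simp only [MultilinearMap.compLinearMap_apply, Pi.basisFun_apply]
    convert h using 1 <;> refine congrArg α ?_ <;> ext i : 1 <;> fin_cases i <;> rfl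
  have h' := congrArg (fun f => f ![u, v, w]) h
  simp only [MultilinearMap.compLinearMap_apply] at h'
  convert h' using 1 <;> refine congrArg α ?_ <;> ext i : 1 <;> fin_cases i <;> rfl

end

/-- A traceless `J` with `J² = s²`, `s ≠ 0`, has eigenvalues `s, s, s, -s, -s, -s` in a basis. -/
theorem exists_eigenbasis {J : (Fin 6 → ℝ) →ₗ[ℝ] (Fin 6 → ℝ)} {s : ℝ} (hs : s ≠ 0)
    (hJJ : J ∘ₗ J = (s * s) • LinearMap.id) (htr : LinearMap.trace ℝ (Fin 6 → ℝ) J = 0) :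
    ∃ B : Module.Basis (Fin 6) ℝ (Fin 6 → ℝ),
      ∀ i, J (B i) = (if i < 3 then s else -s) • B i := by
  set P : (Fin 6 → ℝ) →ₗ[ℝ] (Fin 6 → ℝ) := (1 / 2 : ℝ) • (LinearMap.id + s⁻¹ • J) with hP
  have hJJ' (v) : J (J v) = (s * s) • v := LinearMap.congr_fun hJJ v
  have hPP : IsIdempotentElem P := by
    refine LinearMap.ext fun v => ?_
    simp only [hP, Module.End.mul_apply, LinearMap.smul_apply, LinearMap.add_apply, map_smul,
      map_add, hJJ', LinearMap.id_apply]
    match_scalars <;> field_simp <;> norm_num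
  have htrP : LinearMap.trace ℝ (Fin 6 → ℝ) P = 3 := by
    simp [hP, htr]
    norm_num
  have hrange : Module.finrank ℝ (LinearMap.range P) = 3 := by
    have := (LinearMap.IsIdempotentElem.isProj_range P hPP).trace
    rw [htrP] at this
    exact_mod_cast this.symm
  have hker : Module.finrank ℝ (LinearMap.ker P) = 3 := by
    have := P.finrank_range_add_finrank_ker
    rw [hrange, Module.finrank_fin_fun] at this
    omega
  let B := ((Module.finBasisOfFinrankEq ℝ _ hrange).prod
    (Module.finBasisOfFinrankEq ℝ _ hker)).map
      (Submodule.prodEquivOfIsCompl _ _ (LinearMap.IsIdempotentElem.isCompl hPP))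
  have hpos (v) (hv : v ∈ LinearMap.range P) : J v = s • v := by
    obtain ⟨w, rfl⟩ := hv
    simp only [hP, LinearMap.smul_apply, LinearMap.add_apply, map_smul,
      map_add, hJJ', LinearMap.id_apply]
    match_scalars <;> field_simp
  have hneg (v) (hv : v ∈ LinearMap.ker P) : J v = (-s) • v := by
    simp only [LinearMap.mem_ker, hP, LinearMap.smul_apply, LinearMap.add_apply,
      LinearMap.id_apply] at hv
    have h := congrArg (fun w => (2 * s) • w) hv
    simp only [smul_add, smul_smul, smul_zero] at h
    have h1 : 2 * s * (1 / 2 * s⁻¹) = 1 := by field_simp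
    have h2 : 2 * s * (1 / 2) = s := by ring
    rw [h1, h2, one_smul] at h
    rw [neg_smul, eq_neg_iff_add_eq_zero, add_comm, h]
  refine ⟨B.reindex finSumFinEquiv, fun i => ?_⟩
  obtain ⟨x, rfl⟩ := (finSumFinEquiv (m := 3) (n := 3)).surjective i
  have hBx : B.reindex finSumFinEquiv (finSumFinEquiv x) = B x := by
    rw [Module.Basis.reindex_apply, Equiv.symm_apply_apply]
  rw [hBx]
  rcases x with i | i
  · rw [if_pos (by exact i.isLt)]
    apply hpos
    simp [B, -LinearMap.mem_range]
  · rw [if_neg (by exact (Nat.le_add_right 3 i).not_gt)]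
    apply hneg
    simp [B, -LinearMap.mem_ker]

theorem IsSkewArray.ext_of_lt {A A' : Fin 6 → Fin 6 → Fin 6 → ℝ} (h : IsSkewArray A)
    (h' : IsSkewArray A') (H : ∀ i j k, i < j → j < k → A i j k = A' i j k) : A = A' := by
  ext i j k
  by_cases hij : i = j
  · rw [hij, h.eq_zero_left, h'.eq_zero_left]
  by_cases hjk : j = k
  · rw [hjk, h.eq_zero_right, h'.eq_zero_right]
  by_cases hik : i = k
  · rw [hik, h.eq_zero_outer, h'.eq_zero_outer]
  rcases lt_or_gt_of_ne hij with hij | hij <;> rcases lt_or_gt_of_ne hjk with hjk | hjk <;>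
    rcases lt_or_gt_of_ne hik with hik | hik <;>
    grind [h.swap_left, h.swap_right, h'.swap_left, h'.swap_right]

theorem coeff_injective : Function.Injective coeff := by
  intro α β h
  refine Module.Basis.ext_alternating (Pi.basisFun ℝ (Fin 6)) fun v _ => ?_
  have h' : coeff α (v 0) (v 1) (v 2) = coeff β (v 0) (v 1) (v 2) := by rw [h]
  simp only [Pi.basisFun_apply]
  unfold coeff at h'
  convert h' using 2 <;> ext i : 1 <;> fin_cases i <;> rfl

theorem sorted_triple : ∀ i j k : Fin 6, i < j → j < k →
    (i = 0 ∧ j = 1 ∧ k = 2) ∨ (i = 3 ∧ j = 4 ∧ k = 5) ∨ (i < 3 ∧ 3 ≤ k) := by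
  decide

theorem coeff_dx3 (a b c i j k : Fin 6) : coeff (dx3 a b c) i j k =
    Matrix.det !![(Pi.single i 1 : Fin 6 → ℝ) a, (Pi.single i 1 : Fin 6 → ℝ) b,
        (Pi.single i 1 : Fin 6 → ℝ) c;
      (Pi.single j 1 : Fin 6 → ℝ) a, (Pi.single j 1 : Fin 6 → ℝ) b,
        (Pi.single j 1 : Fin 6 → ℝ) c;
      (Pi.single k 1 : Fin 6 → ℝ) a, (Pi.single k 1 : Fin 6 → ℝ) b,
        (Pi.single k 1 : Fin 6 → ℝ) c] := by
  rw [coeff, dx3, AlternatingMap.compLinearMap_apply, detRowAlternating_apply]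
  congr 1
  ext x y
  fin_cases x <;> fin_cases y <;> rfl

theorem coeff_alphaI (i j k : Fin 6) :
    coeff alphaI i j k = coeff (dx3 0 1 2) i j k + coeff (dx3 3 4 5) i j k :=
  rfl

theorem coeff_alphaI_zero_one_two : coeff alphaI 0 1 2 = 1 := by
  simp [coeff_alphaI, coeff_dx3, Matrix.det_fin_three]

theorem coeff_alphaI_three_four_five : coeff alphaI 3 4 5 = 1 := by
  simp [coeff_alphaI, coeff_dx3, Matrix.det_fin_three]

theorem coeff_alphaI_eq_zero {i k : Fin 6} (j : Fin 6) (hi : i < 3) (hk : 3 ≤ k) :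
    coeff alphaI i j k = 0 := by
  have h0 : k ≠ 0 := by rintro rfl; exact absurd hk (by decide)
  have h1 : k ≠ 1 := by rintro rfl; exact absurd hk (by decide)
  have h2 : k ≠ 2 := by rintro rfl; exact absurd hk (by decide)
  have h3 : i ≠ 3 := hi.ne
  have h4 : i ≠ 4 := by rintro rfl; exact absurd hi (by decide)
  have h5 : i ≠ 5 := by rintro rfl; exact absurd hi (by decide)
  simp [coeff_alphaI, coeff_dx3, Matrix.det_fin_three, Pi.single_apply, h0.symm, h1.symm, h2.symm,
    h3.symm, h4.symm, h5.symm]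

theorem eq_alphaI {β : AlternatingMap ℝ (Fin 6 → ℝ) ℝ (Fin 3)}
    (hβ : ∀ i j k : Fin 6, i < 3 → 3 ≤ k → coeff β i j k = 0) (h012 : coeff β 0 1 2 = 1)
    (h345 : coeff β 3 4 5 = 1) : β = alphaI := by
  refine coeff_injective ((isSkewArray_coeff β).ext_of_lt (isSkewArray_coeff alphaI)
    fun i j k hij hjk => ?_)
  rcases sorted_triple i j k hij hjk with ⟨rfl, rfl, rfl⟩ | ⟨rfl, rfl, rfl⟩ | ⟨hi, hk⟩
  · rw [h012, coeff_alphaI_zero_one_two]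
  · rw [h345, coeff_alphaI_three_four_five]
  · rw [hβ i j k hi hk, coeff_alphaI_eq_zero j hi hk]

theorem coeff_comp_equivFun_symm (α : AlternatingMap ℝ (Fin 6 → ℝ) ℝ (Fin 3))
    (B : Module.Basis (Fin 6) ℝ (Fin 6 → ℝ)) (i j k : Fin 6) :
    coeff (α.compLinearMap (B.equivFun.symm : (Fin 6 → ℝ) →ₗ[ℝ] Fin 6 → ℝ)) i j k =
      α ![B i, B j, B k] := by
  rw [coeff, AlternatingMap.compLinearMap_apply]
  congr 1
  ext x : 1
  fin_cases x <;> simp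

theorem exists_coeff_ne_zero {β : AlternatingMap ℝ (Fin 6 → ℝ) ℝ (Fin 3)}
    (hβ : Function.Injective (fun v : Fin 6 → ℝ => β.curryLeft v)) (i : Fin 6) :
    ∃ j k, coeff β i j k ≠ 0 := by
  by_contra! h
  have hz : β.curryLeft (Pi.single i 1) = β.curryLeft 0 := by
    rw [map_zero]
    refine Module.Basis.ext_alternating (Pi.basisFun ℝ (Fin 6)) fun v _ => ?_
    rw [AlternatingMap.curryLeft_apply_apply, AlternatingMap.zero_apply, ← h (v 0) (v 1), coeff]
    congr 1
    ext x : 1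
    fin_cases x <;> simp
  have := congrFun (hβ hz) i
  simp at this

theorem coeff_ne_zero {β : AlternatingMap ℝ (Fin 6 → ℝ) ℝ (Fin 3)}
    (hβ : Function.Injective (fun v : Fin 6 → ℝ => β.curryLeft v))
    (hmix : ∀ i j k : Fin 6, i < 3 → 3 ≤ k → coeff β i j k = 0) :
    coeff β 0 1 2 ≠ 0 ∧ coeff β 3 4 5 ≠ 0 := by
  have h := isSkewArray_coeff β
  constructor
  · intro h0
    obtain ⟨j, k, hjk⟩ := exists_coeff_ne_zero hβ 0
    have hk : ¬ 3 ≤ k := fun hk => hjk (hmix _ _ _ (by decide) hk)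
    have hj : ¬ 3 ≤ j := fun hj => hjk (by rw [h.swap_right, hmix _ _ _ (by decide) hj, neg_zero])
    have h0' : coeff β 0 2 1 = 0 := by rw [h.swap_right, h0, neg_zero]
    have hcases : ∀ x : Fin 6, ¬ 3 ≤ x → x = 0 ∨ x = 1 ∨ x = 2 := by decide
    rcases hcases j hj with rfl | rfl | rfl <;> rcases hcases k hk with rfl | rfl | rfl <;>
      simp [h0, h0', h.eq_zero_left, h.eq_zero_right, h.eq_zero_outer] at hjk
  · intro h0
    obtain ⟨j, k, hjk⟩ := exists_coeff_ne_zero hβ 3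
    have hj : ¬ j < 3 := fun hj => hjk (by
      rw [h.swap_left, h.swap_right, hmix _ _ _ hj le_rfl, neg_zero, neg_zero])
    have hk : ¬ k < 3 := fun hk => hjk (by
      rw [h.swap_right, h.swap_left, h.swap_right, hmix _ _ _ hk le_rfl]; simp)
    have h0' : coeff β 3 5 4 = 0 := by rw [h.swap_right, h0, neg_zero]
    have hcases : ∀ x : Fin 6, ¬ x < 3 → x = 3 ∨ x = 4 ∨ x = 5 := by decide
    rcases hcases j hj with rfl | rfl | rfl <;> rcases hcases k hk with rfl | rfl | rfl <;>
      simp [h0, h0', h.eq_zero_left, h.eq_zero_right, h.eq_zero_outer] at hjk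

theorem injective_curryLeft_compLinearMap {α : AlternatingMap ℝ (Fin 6 → ℝ) ℝ (Fin 3)}
    (hα : Function.Injective (fun v : Fin 6 → ℝ => α.curryLeft v))
    (g : (Fin 6 → ℝ) ≃ₗ[ℝ] (Fin 6 → ℝ)) :
    Function.Injective (fun v : Fin 6 → ℝ =>
      (α.compLinearMap (g : (Fin 6 → ℝ) →ₗ[ℝ] Fin 6 → ℝ)).curryLeft v) := by
  intro v w hvw
  simp only [AlternatingMap.curryLeft_compLinearMap] at hvw
  exact g.injective (hα (AlternatingMap.compLinearMap_injective _ g.surjective hvw))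

theorem apply_eq_zero_of_eigenvectors {α : AlternatingMap ℝ (Fin 6 → ℝ) ℝ (Fin 3)}
    {J : (Fin 6 → ℝ) →ₗ[ℝ] (Fin 6 → ℝ)}
    (hJ : ∀ v : Fin 6 → ℝ, wedge (α.curryLeft v) α = dvol.curryLeft (J v)) {s : ℝ} (hs : s ≠ 0)
    {u w : Fin 6 → ℝ} (v : Fin 6 → ℝ) (hu : J u = s • u) (hw : J w = -s • w) :
    α ![u, v, w] = 0 := by
  have h : α ![J u, v, w] = α ![u, v, J w] := by
    rw [map_swap_right, apply_left_comm hJ, map_swap_right, neg_neg]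
  have h1 : α ![s • u, v, w] = s * α ![u, v, w] := apply_smul_left ..
  have h2 : α ![u, v, -s • w] = -s * α ![u, v, w] := by
    rw [map_swap_right, map_swap_left, apply_smul_left, map_swap_left, map_swap_right α u]
    ring
  rw [hu, hw, h1, h2] at h
  have : 2 * s * α ![u, v, w] = 0 := by linarith
  simpa [hs] using this

/-- The positive case: rescaling an eigenbasis of `J` brings `α` to the normal form. -/
theorem exists_equiv_alphaI {α : AlternatingMap ℝ (Fin 6 → ℝ) ℝ (Fin 3)}
    (hα : Function.Injective (fun v : Fin 6 → ℝ => α.curryLeft v))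
    {J : (Fin 6 → ℝ) →ₗ[ℝ] (Fin 6 → ℝ)}
    (hJ : ∀ v : Fin 6 → ℝ, wedge (α.curryLeft v) α = dvol.curryLeft (J v)) {s : ℝ} (hs : s ≠ 0)
    (hJJ : J ∘ₗ J = (s * s) • LinearMap.id) :
    ∃ g : (Fin 6 → ℝ) ≃ₗ[ℝ] (Fin 6 → ℝ),
      α.compLinearMap (g : (Fin 6 → ℝ) →ₗ[ℝ] (Fin 6 → ℝ)) = alphaI := by
  obtain ⟨B, hB⟩ := exists_eigenbasis hs hJJ (trace_eq_zero hJ)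
  have hmix (i j k : Fin 6) (hi : i < 3) (hk : 3 ≤ k) (v : Fin 6 → ℝ) :
      α ![B i, v, B k] = 0 :=
    apply_eq_zero_of_eigenvectors hJ hs v (by rw [hB, if_pos hi]) (by rw [hB, if_neg hk.not_gt])
  have hne := coeff_ne_zero (injective_curryLeft_compLinearMap hα B.equivFun.symm)
    fun i j k hi hk => by rw [coeff_comp_equivFun_symm, hmix i j k hi hk]
  simp only [coeff_comp_equivFun_symm] at hne
  obtain ⟨h012, h345⟩ := hne
  let c : Fin 6 → ℝ := ![(α ![B 0, B 1, B 2])⁻¹, 1, 1, (α ![B 3, B 4, B 5])⁻¹, 1, 1]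
  have hc (i : Fin 6) : IsUnit (c i) := by
    fin_cases i <;> simp [c, h012, h345]
  refine ⟨(B.isUnitSMul hc).equivFun.symm, eq_alphaI (fun i j k hi hk => ?_) ?_ ?_⟩ <;>
    rw [coeff_comp_equivFun_symm] <;> simp only [Module.Basis.isUnitSMul_apply]
  · rw [map_swap_right, map_swap_left, apply_smul_left, map_swap_left, map_swap_right α (c i • _),
      apply_smul_left, hmix i j k hi hk]
    simp
  · simp [c, apply_smul_left, h012]
  · simp [c, apply_smul_left, h345]

theorem wedge_compLinearMap (a : AlternatingMap ℝ (Fin 6 → ℝ) ℝ (Fin 2))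
    (b : AlternatingMap ℝ (Fin 6 → ℝ) ℝ (Fin 3)) (g : (Fin 6 → ℝ) →ₗ[ℝ] (Fin 6 → ℝ)) :
    wedge (a.compLinearMap g) (b.compLinearMap g) = (wedge a b).compLinearMap g := by
  have h2 (x y) : a.compLinearMap g ![x, y] = a ![g x, g y] := by
    rw [AlternatingMap.compLinearMap_apply]
    congr 1
    ext i : 1
    fin_cases i <;> rfl
  have h3 (x y z) : b.compLinearMap g ![x, y, z] = b ![g x, g y, g z] := by
    rw [AlternatingMap.compLinearMap_apply]
    congr 1
    ext i : 1
    fin_cases i <;> rfl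
  refine AlternatingMap.ext fun f => ?_
  rw [AlternatingMap.compLinearMap_apply, wedge_two_three_apply, wedge_two_three_apply]
  simp only [h2, h3]

theorem dvol_compLinearMap (g : (Fin 6 → ℝ) →ₗ[ℝ] (Fin 6 → ℝ)) :
    dvol.compLinearMap g = LinearMap.det g • dvol := by
  have h : dvol = (Pi.basisFun ℝ (Fin 6)).det := Pi.basisFun_det.symm
  refine AlternatingMap.ext fun f => ?_
  rw [h, AlternatingMap.compLinearMap_apply, AlternatingMap.smul_apply, smul_eq_mul,
    ← Module.Basis.det_comp]
  rfl

theorem hitchinMatrix_coeff_alphaI :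
    (hitchinMatrix (coeff alphaI) * hitchinMatrix (coeff alphaI)) 0 0 = 1 := by
  rw [(isSkewArray_coeff _).hitchinMatrix_eq, Matrix.mul_apply]
  simp [Fin.sum_univ_six, coeff_alphaI_eq_zero, coeff_alphaI_zero_one_two,
    coeff_alphaI_three_four_five]

theorem trace_comp_self_pos {α : AlternatingMap ℝ (Fin 6 → ℝ) ℝ (Fin 3)}
    {J : (Fin 6 → ℝ) →ₗ[ℝ] (Fin 6 → ℝ)}
    (hJ : ∀ v : Fin 6 → ℝ, wedge (α.curryLeft v) α = dvol.curryLeft (J v))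
    (g : (Fin 6 → ℝ) ≃ₗ[ℝ] (Fin 6 → ℝ))
    (hg : α.compLinearMap (g : (Fin 6 → ℝ) →ₗ[ℝ] (Fin 6 → ℝ)) = alphaI) :
    0 < LinearMap.trace ℝ (Fin 6 → ℝ) (J ∘ₗ J) := by
  set d := LinearMap.det (g : (Fin 6 → ℝ) →ₗ[ℝ] (Fin 6 → ℝ)) with hd
  obtain ⟨J', hJ'_eq⟩ : ∃ J' : (Fin 6 → ℝ) →ₗ[ℝ] (Fin 6 → ℝ), J' = d • g.symm.conj J := ⟨_, rfl⟩
  have hJ' (v : Fin 6 → ℝ) : wedge (alphaI.curryLeft v) alphaI = dvol.curryLeft (J' v) := by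
    rw [hJ'_eq, ← hg, AlternatingMap.curryLeft_compLinearMap, wedge_compLinearMap]
    have h : J (g v) = g (g.symm.conj J v) := by simp [LinearEquiv.conj_apply]
    rw [LinearEquiv.coe_coe, hJ, h, ← LinearEquiv.coe_coe g,
      ← AlternatingMap.curryLeft_compLinearMap, dvol_compLinearMap, ← hd,
      AlternatingMap.curryLeft_smul, LinearMap.smul_apply, LinearMap.smul_apply, map_smul]
  have h := congrArg (LinearMap.trace ℝ (Fin 6 → ℝ)) (comp_self_eq hJ')
  rw [hitchinMatrix_coeff_alphaI, hJ'_eq, LinearMap.smul_comp, LinearMap.comp_smul,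
    ← LinearEquiv.conj_comp, map_smul, map_smul, LinearMap.trace_conj', one_smul,
    LinearMap.trace_id, Module.finrank_fin_fun, smul_eq_mul, smul_eq_mul, ← mul_assoc] at h
  refine pos_of_mul_pos_right ?_ (mul_self_nonneg d)
  rw [h]
  norm_num

/-- For a non-degenerate 3-form α on ℝ⁶ with invariant λ_α = trace(J_α ∘ J_α),
where J_α is determined by (ι_v α) ∧ α = ι_{J_α v} dvol, the stated sign condition
on λ_α holds iff α lies in the GL₆(ℝ)-orbit of the corresponding normal form. -/
theorem linear_type_criterion (α : AlternatingMap ℝ (Fin 6 → ℝ) ℝ (Fin 3))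
    (hα : Function.Injective (fun v : Fin 6 → ℝ => α.curryLeft v))
    (J : (Fin 6 → ℝ) →ₗ[ℝ] (Fin 6 → ℝ))
    (hJ : ∀ v : Fin 6 → ℝ, wedge (α.curryLeft v) α = dvol.curryLeft (J v)) :
    (0 < LinearMap.trace ℝ (Fin 6 → ℝ) (J ∘ₗ J)) ↔
      ∃ g : (Fin 6 → ℝ) ≃ₗ[ℝ] (Fin 6 → ℝ),
        α.compLinearMap (g : (Fin 6 → ℝ) →ₗ[ℝ] (Fin 6 → ℝ)) = alphaI := by
  refine ⟨fun h => ?_, fun ⟨g, hg⟩ => trace_comp_self_pos hJ g hg⟩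
  obtain ⟨c, hJJ⟩ : ∃ c : ℝ, J ∘ₗ J = c • LinearMap.id := ⟨_, comp_self_eq hJ⟩
  rw [hJJ, map_smul, LinearMap.trace_id, Module.finrank_fin_fun, smul_eq_mul] at h
  have hc : 0 < c := pos_of_mul_pos_left h (by norm_num)
  rw [← Real.mul_self_sqrt hc.le] at hJJ
  exact exists_equiv_alphaI hα hJ (Real.sqrt_pos.mpr hc).ne' hJJ
end

section
/- The three 3-forms α_(i), α_(ii), α_(iii) on ℝ⁶ are pairwise of different linear type: for no two distinct members β, γ of {α_(i), α_(ii), α_(iii)} does there exist a linear isomorphism g : ℝ⁶ → ℝ⁶ with g*β = γ. -/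
/-- The contraction `ι_v β` squares to zero, i.e. it is a 2-form of rank at most two. -/
def DecomposableContraction (β : AlternatingMap ℝ (Fin 6 → ℝ) ℝ (Fin 3)) (v : Fin 6 → ℝ) : Prop :=
  ∀ a b c d : Fin 6 → ℝ,
    β ![v, a, b] * β ![v, c, d] - β ![v, a, c] * β ![v, b, d] + β ![v, a, d] * β ![v, b, c] = 0

/-- Some nonzero vector has a decomposable contraction with `β`. -/
def HasDecomposableContraction (β : AlternatingMap ℝ (Fin 6 → ℝ) ℝ (Fin 3)) : Prop :=
  ∃ v, v ≠ 0 ∧ DecomposableContraction β v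

/-- Contracting `β` with two vectors whose contractions are decomposable gives zero. -/
def IsotropicContractions (β : AlternatingMap ℝ (Fin 6 → ℝ) ℝ (Fin 3)) : Prop :=
  ∀ u v w, DecomposableContraction β u → DecomposableContraction β v → β ![u, v, w] = 0

lemma compLinearMap_apply_vec3 (β : AlternatingMap ℝ (Fin 6 → ℝ) ℝ (Fin 3))
    (g : (Fin 6 → ℝ) →ₗ[ℝ] (Fin 6 → ℝ)) (a b c : Fin 6 → ℝ) :
    β.compLinearMap g ![a, b, c] = β ![g a, g b, g c] := by
  rw [AlternatingMap.compLinearMap_apply]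
  congr 1
  ext i
  fin_cases i <;> rfl

lemma decomposableContraction_compLinearMap (β : AlternatingMap ℝ (Fin 6 → ℝ) ℝ (Fin 3))
    (g : (Fin 6 → ℝ) ≃ₗ[ℝ] (Fin 6 → ℝ)) (v : Fin 6 → ℝ) :
    DecomposableContraction (β.compLinearMap (g : (Fin 6 → ℝ) →ₗ[ℝ] (Fin 6 → ℝ))) v ↔
      DecomposableContraction β (g v) := by
  simp only [DecomposableContraction, compLinearMap_apply_vec3, LinearEquiv.coe_coe]
  refine ⟨fun h a b c d => ?_, fun h a b c d => h _ _ _ _⟩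
  simpa using h (g.symm a) (g.symm b) (g.symm c) (g.symm d)

lemma hasDecomposableContraction_compLinearMap (β : AlternatingMap ℝ (Fin 6 → ℝ) ℝ (Fin 3))
    (g : (Fin 6 → ℝ) ≃ₗ[ℝ] (Fin 6 → ℝ)) :
    HasDecomposableContraction (β.compLinearMap (g : (Fin 6 → ℝ) →ₗ[ℝ] (Fin 6 → ℝ))) ↔
      HasDecomposableContraction β := by
  simp only [HasDecomposableContraction, decomposableContraction_compLinearMap]
  refine ⟨fun ⟨v, hv, h⟩ => ⟨g v, by simpa using hv, h⟩, fun ⟨v, hv, h⟩ => ?_⟩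
  exact ⟨g.symm v, by simpa using hv, by simpa using h⟩

lemma isotropicContractions_compLinearMap (β : AlternatingMap ℝ (Fin 6 → ℝ) ℝ (Fin 3))
    (g : (Fin 6 → ℝ) ≃ₗ[ℝ] (Fin 6 → ℝ)) :
    IsotropicContractions (β.compLinearMap (g : (Fin 6 → ℝ) →ₗ[ℝ] (Fin 6 → ℝ))) ↔
      IsotropicContractions β := by
  simp only [IsotropicContractions, decomposableContraction_compLinearMap,
    compLinearMap_apply_vec3, LinearEquiv.coe_coe]
  refine ⟨fun h u v w hu hv => ?_, fun h u v w => h _ _ _⟩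
  simpa using h (g.symm u) (g.symm v) (g.symm w) (by simpa using hu) (by simpa using hv)

lemma dx3_apply (i j k : Fin 6) (a b c : Fin 6 → ℝ) :
    dx3 i j k ![a, b, c] =
      a i * b j * c k - a i * b k * c j - a j * b i * c k + a j * b k * c i
        + a k * b i * c j - a k * b j * c i := by
  rw [dx3, AlternatingMap.compLinearMap_apply]
  refine (Matrix.det_fin_three _).trans ?_
  simp [LinearMap.funLeft_apply]

lemma alphaI_apply (a b c : Fin 6 → ℝ) :
    alphaI ![a, b, c] = dx3 0 1 2 ![a, b, c] + dx3 3 4 5 ![a, b, c] := rfl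

lemma alphaII_apply (a b c : Fin 6 → ℝ) :
    alphaII ![a, b, c] = dx3 0 2 4 ![a, b, c] - dx3 0 3 5 ![a, b, c] - dx3 1 2 5 ![a, b, c]
      - dx3 1 3 4 ![a, b, c] := rfl

lemma alphaIII_apply (a b c : Fin 6 → ℝ) :
    alphaIII ![a, b, c] = dx3 0 4 5 ![a, b, c] - dx3 1 3 5 ![a, b, c]
      + dx3 2 3 4 ![a, b, c] := rfl

lemma decomposableContraction_alphaI_single_zero :
    DecomposableContraction alphaI (Pi.single 0 1) := by
  intro a b c d
  simp [alphaI_apply, dx3_apply]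
  ring

lemma decomposableContraction_alphaI_single_one :
    DecomposableContraction alphaI (Pi.single 1 1) := by
  intro a b c d
  simp [alphaI_apply, dx3_apply]
  ring

lemma decomposableContraction_alphaIII_single_zero :
    DecomposableContraction alphaIII (Pi.single 0 1) := by
  intro a b c d
  simp [alphaIII_apply, dx3_apply]
  ring

lemma hasDecomposableContraction_alphaI : HasDecomposableContraction alphaI :=
  ⟨Pi.single 0 1, by simp, decomposableContraction_alphaI_single_zero⟩

lemma hasDecomposableContraction_alphaIII : HasDecomposableContraction alphaIII :=
  ⟨Pi.single 0 1, by simp, decomposableContraction_alphaIII_single_zero⟩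

lemma not_hasDecomposableContraction_alphaII : ¬ HasDecomposableContraction alphaII := by
  rintro ⟨v, hv, h⟩
  have h₀ := h (Pi.single 2 1) (Pi.single 3 1) (Pi.single 4 1) (Pi.single 5 1)
  have h₁ := h (Pi.single 0 1) (Pi.single 1 1) (Pi.single 4 1) (Pi.single 5 1)
  have h₂ := h (Pi.single 0 1) (Pi.single 1 1) (Pi.single 2 1) (Pi.single 3 1)
  simp [alphaII_apply, dx3_apply] at h₀ h₁ h₂
  apply hv
  ext i
  fin_cases i <;> simp <;> nlinarith

lemma not_isotropicContractions_alphaI : ¬ IsotropicContractions alphaI := by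
  intro h
  have h₀ := h _ _ (Pi.single 2 1) decomposableContraction_alphaI_single_zero
    decomposableContraction_alphaI_single_one
  simp [alphaI_apply, dx3_apply] at h₀

lemma apply_eq_zero_of_decomposableContraction_alphaIII {v : Fin 6 → ℝ}
    (h : DecomposableContraction alphaIII v) : v 3 = 0 ∧ v 4 = 0 ∧ v 5 = 0 := by
  have h₃ := h (Pi.single 1 1) (Pi.single 5 1) (Pi.single 2 1) (Pi.single 4 1)
  have h₄ := h (Pi.single 0 1) (Pi.single 5 1) (Pi.single 2 1) (Pi.single 3 1)
  have h₅ := h (Pi.single 0 1) (Pi.single 4 1) (Pi.single 1 1) (Pi.single 3 1)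
  simp [alphaIII_apply, dx3_apply] at h₃ h₄ h₅
  exact ⟨h₃, h₄, h₅⟩

lemma isotropicContractions_alphaIII : IsotropicContractions alphaIII := by
  intro u v w hu hv
  obtain ⟨hu₃, hu₄, hu₅⟩ := apply_eq_zero_of_decomposableContraction_alphaIII hu
  obtain ⟨hv₃, hv₄, hv₅⟩ := apply_eq_zero_of_decomposableContraction_alphaIII hv
  simp [alphaIII_apply, dx3_apply, *]

/-- The three normal forms `α_(i)`, `α_(ii)`, `α_(iii)` are pairwise of different
linear type: no linear isomorphism of `ℝ⁶` pulls one back to another. -/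
theorem normal_forms_pairwise_inequivalent :
    ∀ β γ : AlternatingMap ℝ (Fin 6 → ℝ) ℝ (Fin 3),
      β ∈ ({alphaI, alphaII, alphaIII} : Set (AlternatingMap ℝ (Fin 6 → ℝ) ℝ (Fin 3))) →
      γ ∈ ({alphaI, alphaII, alphaIII} : Set (AlternatingMap ℝ (Fin 6 → ℝ) ℝ (Fin 3))) →
      β ≠ γ →
      ¬ ∃ g : (Fin 6 → ℝ) ≃ₗ[ℝ] (Fin 6 → ℝ),
          β.compLinearMap (g : (Fin 6 → ℝ) →ₗ[ℝ] (Fin 6 → ℝ)) = γ := by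
  rintro β γ hβ hγ hne ⟨g, hg⟩
  have hD := hasDecomposableContraction_compLinearMap β g
  have hI := isotropicContractions_compLinearMap β g
  rw [hg] at hD hI
  have h₁ := hasDecomposableContraction_alphaI
  have h₂ := not_hasDecomposableContraction_alphaII
  have h₃ := hasDecomposableContraction_alphaIII
  have h₁' := not_isotropicContractions_alphaI
  have h₃' := isotropicContractions_alphaIII
  simp only [Set.mem_insert_iff, Set.mem_singleton_iff] at hβ hγ
  rcases hβ with rfl | rfl | rfl <;> rcases hγ with rfl | rfl | rfl <;> tauto
end

section
/- For every real number t < 0 there exists a linear isomorphism g : ℝ⁶ → ℝ⁶ with g*(α^t) = α_(ii). -/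
/-- The diagonal automorphism of `ℝ⁶` that rescales the `i`-th coordinate by `w i`. -/
noncomputable def coordScaling (w : Fin 6 → ℝ) (hw : ∀ i, w i ≠ 0) :
    (Fin 6 → ℝ) ≃ₗ[ℝ] (Fin 6 → ℝ) :=
  LinearEquiv.piCongrRight fun i => LinearEquiv.smulOfNeZero ℝ ℝ (w i) (hw i)

theorem dx3_apply_coordScaling (w : Fin 6 → ℝ) (hw : ∀ i, w i ≠ 0) (i j k : Fin 6)
    (v : Fin 3 → Fin 6 → ℝ) :
    dx3 i j k (fun a => coordScaling w hw (v a)) = w i * w j * w k * dx3 i j k v := by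
  change Matrix.det (Matrix.of fun a b => w (![i, j, k] b) * v a (![i, j, k] b)) =
    w i * w j * w k * Matrix.det (Matrix.of fun a b => v a (![i, j, k] b))
  simp [Matrix.det_fin_three]
  ring

/-- For every `t < 0` there is a linear isomorphism `g` of `ℝ⁶` with `g*(α^t) = α_(ii)`. -/
theorem alphaT_neg_type (t : ℝ) (ht : t < 0) :
    ∃ g : (Fin 6 → ℝ) ≃ₗ[ℝ] (Fin 6 → ℝ),
      (alphaT t).compLinearMap (g : (Fin 6 → ℝ) →ₗ[ℝ] (Fin 6 → ℝ)) = alphaII := by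
  obtain ⟨r, hr, rfl⟩ : ∃ r : ℝ, r ≠ 0 ∧ t = -r ^ 2 :=
    ⟨√(-t), (Real.sqrt_pos.2 (by linarith)).ne', by rw [Real.sq_sqrt (by linarith), neg_neg]⟩
  have hw : ∀ i, (![r, 1, r⁻¹, (r ^ 2)⁻¹, 1, r] : Fin 6 → ℝ) i ≠ 0 := by
    intro i
    fin_cases i <;> simp [hr]
  refine ⟨coordScaling _ hw, ?_⟩
  ext v
  have h := fun i j k => dx3_apply_coordScaling _ hw i j k v
  simp only [alphaT, alphaII, AlternatingMap.compLinearMap_apply, AlternatingMap.add_apply,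
    AlternatingMap.sub_apply, AlternatingMap.smul_apply, smul_eq_mul, LinearEquiv.coe_coe, h]
  simp
  field_simp
  ring
end

section
/- Let f : ℝ⁶ → ℝ be given by f(x) = x₂. Then the linear type of ω^f is not constant on any neighbourhood of 0: for every neighbourhood U of 0 in ℝ⁶ there exist points p, q ∈ U such that no linear isomorphism g : ℝ⁶ → ℝ⁶ satisfies g*(ω^f_q) = ω^f_p. -/
/-- For `f : ℝ⁶ → ℝ`, the field of 3-forms
`ω^f_p = dx^{135} − dx^{146} − dx^{236} + f(p)·dx^{245}` on `ℝ⁶`. -/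
noncomputable def omegaF (f : (Fin 6 → ℝ) → ℝ) (p : Fin 6 → ℝ) :
    AlternatingMap ℝ (Fin 6 → ℝ) ℝ (Fin 3) :=
  dx3 0 2 4 - dx3 0 3 5 - dx3 1 2 5 + f p • dx3 1 3 4

theorem omegaF_apply (f : (Fin 6 → ℝ) → ℝ) (p : Fin 6 → ℝ) (v u w : Fin 6 → ℝ) :
    omegaF f p ![v, u, w] =
      (v 2 * u 4 - v 4 * u 2 - (v 3 * u 5 - v 5 * u 3)) * w 0
      + (-(v 2 * u 5 - v 5 * u 2) + f p * (v 3 * u 4 - v 4 * u 3)) * w 1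
      + (-(v 0 * u 4 - v 4 * u 0) + (v 1 * u 5 - v 5 * u 1)) * w 2
      + ((v 0 * u 5 - v 5 * u 0) - f p * (v 1 * u 4 - v 4 * u 1)) * w 3
      + ((v 0 * u 2 - v 2 * u 0) + f p * (v 1 * u 3 - v 3 * u 1)) * w 4
      + (-(v 0 * u 3 - v 3 * u 0) - (v 1 * u 2 - v 2 * u 1)) * w 5 := by
  have key (i j k : Fin 6) : dx3 i j k ![v, u, w] =
      Matrix.det !![v i, v j, v k; u i, u j, u k; w i, w j, w k] := by
    change Matrix.det (_ : Matrix (Fin 3) (Fin 3) ℝ) = _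
    congr 1
    ext a b
    fin_cases a <;> fin_cases b <;> rfl
  simp only [omegaF, AlternatingMap.add_apply, AlternatingMap.sub_apply,
    AlternatingMap.smul_apply, key, Matrix.det_fin_three, smul_eq_mul]
  simp
  ring

/-- The equations `a x = e b y`, `a y = -b x` with `e > 0` and `(a, b) ≠ 0` force `x = y = 0`. -/
theorem eq_zero_of_rotated_system {e a b x y : ℝ} (he : 0 < e) (hab : ¬(a = 0 ∧ b = 0))
    (h₁ : a * x - e * (b * y) = 0) (h₂ : a * y + b * x = 0) : x = 0 ∧ y = 0 := by
  have hpos : a ^ 2 + e * b ^ 2 ≠ 0 := by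
    intro h
    have ha : a ^ 2 = 0 := by nlinarith [sq_nonneg a, mul_nonneg he.le (sq_nonneg b)]
    have hb : e * b ^ 2 = 0 := by linarith
    refine hab ⟨by simpa using ha, ?_⟩
    simpa [he.ne'] using hb
  constructor
  · refine (mul_eq_zero.mp (?_ : (a ^ 2 + e * b ^ 2) * x = 0)).resolve_left hpos
    linear_combination a * h₁ + e * b * h₂
  · refine (mul_eq_zero.mp (?_ : (a ^ 2 + e * b ^ 2) * y = 0)).resolve_left hpos
    linear_combination a * h₂ - b * h₁

/-- If `f p < 0` and `v ≠ 0`, the kernel of the 2-form `ι_v ω^f_p` meets the common kernel of some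
two coordinate functions trivially; in particular its dimension is at most two. -/
theorem exists_coords_of_omegaF_neg {f : (Fin 6 → ℝ) → ℝ} {p : Fin 6 → ℝ} (hp : f p < 0)
    {v : Fin 6 → ℝ} (hv : v ≠ 0) :
    ∃ i j : Fin 6, ∀ u : Fin 6 → ℝ, (∀ w, omegaF f p ![v, u, w] = 0) →
      u i = 0 → u j = 0 → u = 0 := by
  have he : 0 < -f p := neg_pos.mpr hp
  have coeffs (u : Fin 6 → ℝ) (h : ∀ w, omegaF f p ![v, u, w] = 0) :
      v 2 * u 4 - v 4 * u 2 - (v 3 * u 5 - v 5 * u 3) = 0 ∧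
      -(v 2 * u 5 - v 5 * u 2) + f p * (v 3 * u 4 - v 4 * u 3) = 0 ∧
      -(v 0 * u 4 - v 4 * u 0) + (v 1 * u 5 - v 5 * u 1) = 0 ∧
      (v 0 * u 5 - v 5 * u 0) - f p * (v 1 * u 4 - v 4 * u 1) = 0 ∧
      (v 0 * u 2 - v 2 * u 0) + f p * (v 1 * u 3 - v 3 * u 1) = 0 ∧
      -(v 0 * u 3 - v 3 * u 0) - (v 1 * u 2 - v 2 * u 1) = 0 := by
    simp only [omegaF_apply] at h
    refine ⟨?_, ?_, ?_, ?_, ?_, ?_⟩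
    · simpa using h (Pi.single 0 1)
    · simpa using h (Pi.single 1 1)
    · simpa using h (Pi.single 2 1)
    · simpa using h (Pi.single 3 1)
    · simpa using h (Pi.single 4 1)
    · simpa using h (Pi.single 5 1)
  have vanish (u : Fin 6 → ℝ) (h0 : u 0 = 0) (h1 : u 1 = 0) (h2 : u 2 = 0) (h3 : u 3 = 0)
      (h4 : u 4 = 0) (h5 : u 5 = 0) : u = 0 := by
    ext k
    fin_cases k <;> assumption
  by_cases h01 : v 0 = 0 ∧ v 1 = 0
  · by_cases h23 : v 2 = 0 ∧ v 3 = 0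
    · have h54 : ¬(v 5 = 0 ∧ v 4 = 0) := fun h =>
        hv (vanish v h01.1 h01.2 h23.1 h23.2 h.2 h.1)
      refine ⟨4, 5, fun u hu h4 h5 => ?_⟩
      obtain ⟨c0, c1, c2, c3, -, -⟩ := coeffs u hu
      simp only [h01, h23, h4, h5] at c0 c1 c2 c3
      obtain ⟨h2, h3'⟩ := eq_zero_of_rotated_system (x := u 2) (y := -u 3) he h54
        (by linear_combination c1) (by linear_combination -c0)
      obtain ⟨h0, h1'⟩ := eq_zero_of_rotated_system (x := u 0) (y := -u 1) he h54
        (by linear_combination -c3) (by linear_combination c2)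
      exact vanish u h0 (neg_eq_zero.mp h1') h2 (neg_eq_zero.mp h3') h4 h5
    · refine ⟨2, 3, fun u hu h2 h3 => ?_⟩
      obtain ⟨c0, c1, -, -, c4, c5⟩ := coeffs u hu
      simp only [h2, h3] at c0 c1 c4 c5
      obtain ⟨h0, h1⟩ := eq_zero_of_rotated_system (x := u 0) (y := u 1) he h23
        (by linear_combination -c4) (by linear_combination c5)
      obtain ⟨h5, h4'⟩ := eq_zero_of_rotated_system (x := u 5) (y := -u 4) he h23
        (by linear_combination -c1) (by linear_combination -c0)
      exact vanish u h0 h1 h2 h3 (neg_eq_zero.mp h4') h5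
  · refine ⟨0, 1, fun u hu h0 h1 => ?_⟩
    obtain ⟨-, -, c2, c3, c4, c5⟩ := coeffs u hu
    simp only [h0, h1] at c2 c3 c4 c5
    obtain ⟨h2, h3⟩ := eq_zero_of_rotated_system (x := u 2) (y := u 3) he h01
      (by linear_combination c4) (by linear_combination -c5)
    obtain ⟨h5, h4'⟩ := eq_zero_of_rotated_system (x := u 5) (y := -u 4) he h01
      (by linear_combination c3) (by linear_combination c2)
    exact vanish u h0 h1 h2 h3 (neg_eq_zero.mp h4') h5

/-- The forms `ω^f_p` with `f p = 0` and `ω^f_q` with `f q < 0` are not linearly equivalent. -/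
theorem omegaF_compLinearMap_ne {f : (Fin 6 → ℝ) → ℝ} {p q : Fin 6 → ℝ} (hp : f p = 0)
    (hq : f q < 0) (g : (Fin 6 → ℝ) ≃ₗ[ℝ] (Fin 6 → ℝ)) :
    (omegaF f q).compLinearMap (g : (Fin 6 → ℝ) →ₗ[ℝ] (Fin 6 → ℝ)) ≠ omegaF f p := by
  intro hg
  have pull (v u w : Fin 6 → ℝ) : omegaF f q ![g v, g u, g w] = omegaF f p ![v, u, w] := by
    rw [← hg, AlternatingMap.compLinearMap_apply]
    congr 1
    ext a
    fin_cases a <;> rfl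
  have hv : g (Pi.single 1 1) ≠ 0 := by simp
  obtain ⟨i, j, hij⟩ := exists_coords_of_omegaF_neg hq hv
  let h : (Fin 3 → ℝ) →ₗ[ℝ] (Fin 6 → ℝ) :=
    LinearMap.pi ![LinearMap.proj 0, LinearMap.proj 1, 0, LinearMap.proj 2, 0, 0]
  let coords : (Fin 3 → ℝ) →ₗ[ℝ] ℝ × ℝ :=
    ((LinearMap.proj i).prod (LinearMap.proj j)) ∘ₗ g.toLinearMap ∘ₗ h
  have hker : LinearMap.ker coords ≠ ⊥ := LinearMap.ker_ne_bot_of_finrank_lt (by simp)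
  obtain ⟨t, ht, ht0⟩ := (Submodule.ne_bot_iff _).mp hker
  have htc : g (h t) i = 0 ∧ g (h t) j = 0 := by
    simpa [coords] using ht
  have hzero : g (h t) = 0 := by
    refine hij _ (fun w => ?_) htc.1 htc.2
    rw [← g.apply_symm_apply w, pull, omegaF_apply, hp]
    simp [h]
  have hht : h t = 0 := by simpa using hzero
  apply ht0
  ext k
  fin_cases k
  · exact congrFun hht 0
  · exact congrFun hht 1
  · exact congrFun hht 3

/-- For `f(x) = x₂`, the linear type of `ω^f` is non-constant on every
neighbourhood of `0`. -/
theorem omegaF_type_not_locally_constant :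
    ∀ U ∈ nhds (0 : Fin 6 → ℝ), ∃ p ∈ U, ∃ q ∈ U,
      ¬ ∃ g : (Fin 6 → ℝ) ≃ₗ[ℝ] (Fin 6 → ℝ),
          (omegaF (fun x => x 1) q).compLinearMap
            (g : (Fin 6 → ℝ) →ₗ[ℝ] (Fin 6 → ℝ)) = omegaF (fun x => x 1) p := by
  intro U hU
  have hlim : Filter.Tendsto (fun t : ℝ => (Pi.single 1 t : Fin 6 → ℝ)) (nhds 0) (nhds 0) := by
    have hc : Continuous (fun t : ℝ => (Pi.single 1 t : Fin 6 → ℝ)) := continuous_single (A := fun _ => ℝ) 1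
    simpa using hc.tendsto 0
  have hneg : ∀ᶠ t : ℝ in nhdsWithin 0 (Set.Iio 0), (Pi.single 1 t : Fin 6 → ℝ) ∈ U :=
    nhdsWithin_le_nhds (hlim hU)
  obtain ⟨t, htU, ht⟩ := (hneg.and self_mem_nhdsWithin).exists
  refine ⟨0, mem_of_mem_nhds hU, Pi.single 1 t, htU, ?_⟩
  rintro ⟨g, hg⟩
  exact omegaF_compLinearMap_ne rfl (by simpa using ht) g hg
end
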